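/- arXiv:math/9408202 — 3 statements merged into one kernel-verified Lean document; each statement's English description precedes it below -/
import Mathlib

section
/- Assume λ is a cardinal with cf(λ) = ℵ0 < λ, and there are functions η_α : ω → λ for α < λ⁺ such that for every β < λ⁺ there is h_β : β → ω with: whenever α₁ < α₂ < β and k > h_β(α₁) and k > h_β(α₂), then η_{α₁}↾k ≠ η_{α₂}↾k. Then there exists a first countable Hausdorff topological space of cardinality λ⁺ which is λ-metrizable (hence λ-CWH) but not λ⁺-CWH (hence not metrizable). -/
open Cardinal Topology

def SeparatedFamily {X : Type*} [TopologicalSpace X] (Y : Set X) : Prop :=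
  ∃ u : Y → Set X, (∀ y, IsOpen (u y)) ∧ (∀ y, (y : X) ∈ u y) ∧
    ∀ y z : Y, y ≠ z → Disjoint (u y) (u z)

def IsCWH (X : Type*) [TopologicalSpace X] : Prop :=
  ∀ Y : Set X, DiscreteTopology Y → SeparatedFamily Y

/-- A first countable Hausdorff space of cardinality `lam⁺` which is `lam`-metrizable
(every subspace of cardinality `≤ lam` is metrizable) but not `lam⁺`-CWH
(some subspace of cardinality `≤ lam⁺` is not CWH). -/
def Stmt1Space (lam : Cardinal) (X : Type) [TopologicalSpace X] : Prop :=
  FirstCountableTopology X ∧ T2Space X ∧ #X = Order.succ lam ∧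
  (∀ Y : Set X, #Y ≤ lam → TopologicalSpace.MetrizableSpace Y) ∧
  ¬∀ Y : Set X, #Y ≤ Order.succ lam → IsCWH Y

open Filter Set

/-- The points of the space obtained by letting, for each `a : A`, the sequence of isolated points
`r a 0, r a 1, …` of `T` converge to a new point. -/
inductive BranchSpace {A T : Type*} (r : A → ℕ → T)
  | branch (a : A) : BranchSpace r
  | node (t : T) : BranchSpace r

namespace BranchSpace

variable {A T : Type*} {r : A → ℕ → T}

instance : TopologicalSpace (BranchSpace r) where
  IsOpen U := ∀ a, branch a ∈ U → ∃ N, ∀ k, N ≤ k → node (r a k) ∈ U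
  isOpen_univ := fun _ _ => ⟨0, fun _ _ => trivial⟩
  isOpen_inter := by
    intro U V hU hV a ha
    obtain ⟨M, hM⟩ := hU a ha.1
    obtain ⟨N, hN⟩ := hV a ha.2
    exact ⟨max M N, fun k hk =>
      ⟨hM k (le_trans (le_max_left _ _) hk), hN k (le_trans (le_max_right _ _) hk)⟩⟩
  isOpen_sUnion := by
    rintro S hS a ⟨U, hU, ha⟩
    obtain ⟨N, hN⟩ := hS U hU a ha
    exact ⟨N, fun k hk => ⟨U, hU, hN k hk⟩⟩

theorem isOpen_def {U : Set (BranchSpace r)} :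
    IsOpen U ↔ ∀ a, branch a ∈ U → ∃ N, ∀ k, N ≤ k → node (r a k) ∈ U := Iff.rfl

/-- The basic neighbourhood of `branch a` containing the nodes of index at least `N`. -/
def tail (r : A → ℕ → T) (a : A) (N : ℕ) : Set (BranchSpace r) :=
  {x | x = branch a ∨ ∃ k, N ≤ k ∧ x = node (r a k)}

theorem isOpen_tail (a : A) (N : ℕ) : IsOpen (tail r a N) := by
  rintro b (hb | ⟨k, -, hb⟩)
  · obtain rfl : b = a := by simpa using hb
    exact ⟨N, fun k hk => Or.inr ⟨k, hk, rfl⟩⟩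
  · cases hb

theorem branch_mem_tail (a : A) (N : ℕ) : branch a ∈ tail r a N := Or.inl rfl

theorem nhds_branch_hasBasis (a : A) :
    (𝓝 (branch a : BranchSpace r)).HasBasis (fun _ : ℕ => True) (tail r a) := by
  refine ⟨fun s => ⟨fun hs => ?_, ?_⟩⟩
  · obtain ⟨U, hUs, hU, ha⟩ := mem_nhds_iff.1 hs
    obtain ⟨N, hN⟩ := hU a ha
    refine ⟨N, trivial, ?_⟩
    rintro x (rfl | ⟨k, hk, rfl⟩)
    · exact hUs ha
    · exact hUs (hN k hk)
  · rintro ⟨N, -, hN⟩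
    exact mem_of_superset ((isOpen_tail a N).mem_nhds (branch_mem_tail a N)) hN

theorem isOpen_node (t : T) : IsOpen ({node t} : Set (BranchSpace r)) := by
  intro a ha
  cases ha

theorem nhds_node (t : T) : 𝓝 (node t : BranchSpace r) = pure (node t) :=
  isOpen_singleton_iff_nhds_eq_pure _ |>.1 (isOpen_node t)

instance : FirstCountableTopology (BranchSpace r) where
  nhds_generated_countable := by
    rintro (a | t)
    · exact (nhds_branch_hasBasis a).isCountablyGenerated
    · rw [nhds_node]
      infer_instance

/-- The equivalence of `BranchSpace r` with the disjoint union of its branches and nodes. -/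
def equivSum (r : A → ℕ → T) : BranchSpace r ≃ A ⊕ T where
  toFun | branch a => Sum.inl a | node t => Sum.inr t
  invFun | Sum.inl a => branch a | Sum.inr t => node t
  left_inv := by rintro (_ | _) <;> rfl
  right_inv := by rintro (_ | _) <;> rfl

/-- The branches in `S` can be made disjoint by removing finitely many nodes from each. -/
def Free (r : A → ℕ → T) (S : Set A) : Prop :=
  ∃ h : A → ℕ, ∀ a ∈ S, ∀ b ∈ S, a ≠ b → ∀ k, h a < k → h b < k → r a k ≠ r b k

theorem Free.mono {S S' : Set A} (hS : Free r S) (h : S' ⊆ S) : Free r S' := by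
  obtain ⟨f, hf⟩ := hS
  exact ⟨f, fun a ha b hb => hf a (h ha) b (h hb)⟩

variable {len : T → ℕ}

theorem t2Space (hlen : ∀ a k, len (r a k) = k) (hr : ∀ a b, Free r {a, b}) :
    T2Space (BranchSpace r) := by
  have key : ∀ (a : A) (t : T), node t ∉ tail r a (len t + 1) := by
    rintro a t (h | ⟨k, hk, h⟩)
    · cases h
    · obtain rfl : t = r a k := by simpa using h
      rw [hlen] at hk
      omega
  refine ⟨?_⟩
  rintro (a | s) (b | t) hne
  · have hab : a ≠ b := fun h => hne (h ▸ rfl)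
    obtain ⟨h, hh⟩ := hr a b
    refine ⟨_, _, isOpen_tail a (max (h a) (h b) + 1), isOpen_tail b (max (h a) (h b) + 1),
      branch_mem_tail _ _, branch_mem_tail _ _, Set.disjoint_left.2 ?_⟩
    rintro x (rfl | ⟨k, hk, rfl⟩) (h' | ⟨l, hl, h'⟩)
    · exact hne h'
    · cases h'
    · cases h'
    · have he : r a k = r b l := by simpa using h'
      obtain rfl : k = l := by rw [← hlen a k, he, hlen]
      exact hh a (by simp) b (by simp) hab k (by omega) (by omega) he
  · exact ⟨_, _, isOpen_tail a (len t + 1), isOpen_node t, branch_mem_tail _ _, rfl,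
      Set.disjoint_singleton_right.2 (key a t)⟩
  · exact ⟨_, _, isOpen_node s, isOpen_tail b (len s + 1), rfl, branch_mem_tail _ _,
      Set.disjoint_singleton_left.2 (key b s)⟩
  · exact ⟨_, _, isOpen_node s, isOpen_node t, rfl, rfl, by simpa using hne⟩

open Classical in
/-- The map sending each node `r a k` with `a ∈ S`, `n ≤ k` and `h a < k` to such a branch `a`,
and fixing all other points. -/
noncomputable def collapse (r : A → ℕ → T) (S : Set A) (h : A → ℕ) (n : ℕ) :
    BranchSpace r → A ⊕ T
  | branch a => Sum.inl a
  | node t => if H : ∃ a ∈ S, ∃ k, n ≤ k ∧ h a < k ∧ r a k = t then Sum.inl H.choose else Sum.inr t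

variable {S : Set A} {h : A → ℕ}

theorem mem_tail_of_collapse_eq {n : ℕ} {x : BranchSpace r} {a : A}
    (hx : collapse r S h n x = Sum.inl a) : x ∈ tail r a n := by
  cases x with
  | branch b => exact Or.inl (by simpa [collapse] using hx)
  | node t =>
    rw [collapse] at hx
    split_ifs at hx with H
    obtain ⟨-, k, hk, -, ht⟩ := H.choose_spec
    rw [Sum.inl.inj hx] at ht
    exact Or.inr ⟨k, hk, by rw [ht]⟩

theorem eq_node_of_collapse_eq {n : ℕ} {x : BranchSpace r} {t : T}
    (hx : collapse r S h n x = Sum.inr t) : x = node t := by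
  cases x with
  | branch b => simp [collapse] at hx
  | node s =>
    rw [collapse] at hx
    split_ifs at hx
    rw [Sum.inr.inj hx]

theorem collapse_node_of_len_lt (hlen : ∀ a k, len (r a k) = k) {n : ℕ} {t : T} (hn : len t < n) :
    collapse r S h n (node t) = Sum.inr t := by
  rw [collapse, dif_neg]
  rintro ⟨a, -, k, hk, -, rfl⟩
  rw [hlen] at hn
  omega

theorem collapse_eq_of_mem_tail (hlen : ∀ a k, len (r a k) = k)
    (hh : ∀ a ∈ S, ∀ b ∈ S, a ≠ b → ∀ k, h a < k → h b < k → r a k ≠ r b k)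
    {n : ℕ} {a : A} (ha : a ∈ S) {x : BranchSpace r} (hx : x ∈ tail r a (max n (h a + 1))) :
    collapse r S h n x = Sum.inl a := by
  rcases hx with rfl | ⟨k, hk, rfl⟩
  · rfl
  · have H : ∃ b ∈ S, ∃ l, n ≤ l ∧ h b < l ∧ r b l = r a k :=
      ⟨a, ha, k, by omega, by omega, rfl⟩
    rw [collapse, dif_pos H]
    obtain ⟨hb, l, -, hl, he⟩ := H.choose_spec
    obtain rfl : l = k := by rw [← hlen H.choose l, he, hlen]
    by_contra hne
    exact hh _ hb a ha (fun h' => hne (by rw [h'])) l hl (by omega) he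

theorem metrizableSpace_of_free [T2Space (BranchSpace r)] (hlen : ∀ a k, len (r a k) = k)
    (Y : Set (BranchSpace r)) (hY : Free r {a | branch a ∈ Y}) :
    TopologicalSpace.MetrizableSpace Y := by
  obtain ⟨h, hh⟩ := hY
  let _ : TopologicalSpace (A ⊕ T) := ⊥
  have : DiscreteTopology (A ⊕ T) := ⟨rfl⟩
  let F : Y → ℕ → A ⊕ T := fun y n => collapse r {a | branch a ∈ Y} h n y
  have hloc : ∀ (y : Y) (n : ℕ), ∀ᶠ z in 𝓝 y, F z n = F y n := by
    rintro ⟨y, hy⟩ n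
    have : ∀ᶠ z in 𝓝 y, collapse r {a | branch a ∈ Y} h n z =
        collapse r {a | branch a ∈ Y} h n y := by
      cases y with
      | branch a =>
        exact (nhds_branch_hasBasis a).eventually_iff.2
          ⟨_, trivial, fun x hx => collapse_eq_of_mem_tail hlen hh hy hx⟩
      | node t => simp [nhds_node]
    exact (continuous_subtype_val.tendsto (⟨y, hy⟩ : Y)).eventually this
  have hF : Continuous F := continuous_pi fun n => continuous_iff_continuousAt.2 fun y => by
    rw [ContinuousAt, nhds_discrete (A ⊕ T), tendsto_pure]
    exact hloc y n
  have hfib : ∀ (y : Y) (n : ℕ), {g : ℕ → A ⊕ T | g n = F y n} ∈ 𝓝 (F y) := fun y n =>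
    ((isOpen_discrete ({F y n} : Set (A ⊕ T))).preimage
      (continuous_apply (A := fun _ : ℕ => A ⊕ T) n)).mem_nhds rfl
  have hind : IsInducing F := by
    refine isInducing_iff_nhds.2 fun y => le_antisymm (hF.tendsto y).le_comap ?_
    intro s hs
    obtain ⟨y, hy⟩ := y
    rw [nhds_subtype, mem_comap] at hs
    obtain ⟨U, hU, hUs⟩ := hs
    cases y with
    | branch a =>
      obtain ⟨n, -, hn⟩ := (nhds_branch_hasBasis a).mem_iff.1 hU
      exact ⟨_, hfib _ n, fun z hz => hUs (hn (mem_tail_of_collapse_eq hz))⟩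
    | node t =>
      refine ⟨_, hfib _ (len t + 1), fun z hz => hUs ?_⟩
      have : (z : BranchSpace r) = node t := eq_node_of_collapse_eq
        (Eq.trans hz (collapse_node_of_len_lt hlen (Nat.lt_succ_self _)))
      rw [mem_preimage, this]
      exact mem_of_mem_nhds hU
  exact hind.isEmbedding.metrizableSpace

end BranchSpace

theorem BranchSpace.not_isCWH_univ {A T : Type} {r : A → ℕ → T} (hc : #T < #A) :
    ¬IsCWH (univ : Set (BranchSpace r)) := by
  intro hcwh
  let p : A → (univ : Set (BranchSpace r)) := fun a => ⟨branch a, trivial⟩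
  have hp : ∀ a b, p a = p b → a = b := fun a b hab =>
    branch.inj (congrArg Subtype.val hab)
  have hdisc : DiscreteTopology (range p) := by
    rw [discreteTopology_iff_isOpen_singleton]
    rintro ⟨_, a, rfl⟩
    have : IsOpen {z : range p | (z : (univ : Set (BranchSpace r))).1 ∈ tail r a 0} :=
      (isOpen_tail a 0).preimage (continuous_subtype_val.comp continuous_subtype_val)
    convert this
    ext ⟨_, b, rfl⟩
    refine ⟨fun h => Or.inl (congrArg (fun z => z.1.1) h), ?_⟩
    rintro (h | ⟨k, -, h⟩)
    · exact Subtype.ext (Subtype.ext h)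
    · cases h
  obtain ⟨u, hu, hmem, hdisj⟩ := hcwh (range p) hdisc
  have hnode : ∀ a, ∃ t, (⟨node t, trivial⟩ : (univ : Set (BranchSpace r))) ∈ u ⟨p a, a, rfl⟩ := by
    intro a
    obtain ⟨V, hV, hVu⟩ := isOpen_induced_iff.1 (hu ⟨p a, a, rfl⟩)
    have haV : branch a ∈ V := by
      have := hmem ⟨p a, a, rfl⟩
      rwa [← hVu] at this
    obtain ⟨N, hN⟩ := hV a haV
    exact ⟨r a N, hVu ▸ hN N le_rfl⟩
  choose t ht using hnode
  refine hc.not_ge (mk_le_of_injective (f := t) fun a b hab => ?_)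
  by_contra hne
  refine Set.disjoint_left.1 (hdisj ⟨p a, a, rfl⟩ ⟨p b, b, rfl⟩
    fun h => hne (hp a b (congrArg Subtype.val h))) (ht a) ?_
  rw [hab]
  exact ht b

theorem stmt1 (lam : Cardinal) (hcf : lam.ord.cof = ℵ₀) (hlam : ℵ₀ < lam)
    (η : Ordinal → ℕ → Ordinal)
    (hrange : ∀ α < (Order.succ lam).ord, ∀ n : ℕ, η α n < lam.ord)
    (hsep : ∀ β < (Order.succ lam).ord, ∃ h : Ordinal → ℕ,
      ∀ α₁ α₂, α₁ < α₂ → α₂ < β → ∀ k : ℕ, h α₁ < k → h α₂ < k →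
        ∃ j < k, η α₁ j ≠ η α₂ j) :
    ∃ (X : Type) (t : TopologicalSpace X), @Stmt1Space lam X t := by
  let A : Type := (Order.succ lam).ord.ToType
  let B : Type := lam.ord.ToType
  let v : A → Ordinal := fun a => (Ordinal.ToType.mk.symm a).1
  have hv : ∀ a, v a < (Order.succ lam).ord := fun a => (Ordinal.ToType.mk.symm a).2
  have hv_inj : Function.Injective v :=
    Subtype.val_injective.comp Ordinal.ToType.mk.symm.injective
  let f : A → ℕ → B := fun a n => Ordinal.ToType.mk ⟨η (v a) n, hrange _ (hv a) n⟩
  have hf : ∀ a b n, f a n = f b n → η (v a) n = η (v b) n := fun a b n hab =>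
    congrArg Subtype.val (Ordinal.ToType.mk.injective hab)
  let r : A → ℕ → List B := fun a k => (List.range k).map (f a)
  have hlen : ∀ a k, (r a k).length = k := by simp [r]
  have hA : #A = Order.succ lam := by simp [A]
  have hB : #B = lam := by simp [B]
  have hBinf : Infinite B := by
    rw [infinite_iff, hB]
    exact hlam.le
  have hT : #(List B) = lam := by rw [mk_list_eq_mk, hB]
  have hreg : (Order.succ lam).IsRegular := isRegular_succ hlam.le
  have hfree : ∀ S : Set A, #S ≤ lam → BranchSpace.Free r S := by
    intro S hS
    have hβ : ⨆ a : S, v a + 1 < (Order.succ lam).ord := by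
      refine Ordinal.iSup_lt_of_lt_cof ?_ fun a => ?_
      · rw [hreg.cof_ord]
        exact Order.lt_succ_of_le hS
      · exact (isSuccLimit_ord hreg.aleph0_le).add_one_lt (hv a)
    obtain ⟨h, hh⟩ := hsep _ hβ
    have hlt : ∀ a ∈ S, v a < ⨆ a : S, v a + 1 := fun a ha =>
      Ordinal.lt_iSup_add_one (f := fun a : S => v a) ⟨a, ha⟩
    have hneq : ∀ a ∈ S, ∀ b ∈ S, v a < v b → ∀ k, h (v a) < k → h (v b) < k →
        r a k ≠ r b k := by
      intro a _ b hb hab k hka hkb he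
      obtain ⟨j, hj, hne⟩ := hh _ _ hab (hlt b hb) k hka hkb
      exact hne (hf a b j (List.map_inj_left.1 he j (List.mem_range.2 hj)))
    refine ⟨fun a => h (v a), fun a ha b hb hab k hka hkb => ?_⟩
    rcases lt_or_gt_of_ne (hv_inj.ne hab) with hlt' | hlt'
    · exact hneq a ha b hb hlt' k hka hkb
    · exact (hneq b hb a ha hlt' k hkb hka).symm
  have hT2 : T2Space (BranchSpace r) := BranchSpace.t2Space hlen fun a b =>
    hfree _ ((Set.toFinite {a, b}).lt_aleph0.le.trans hlam.le)
  have hX : #(BranchSpace r) = Order.succ lam := by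
    rw [mk_congr (BranchSpace.equivSum r), mk_sum, lift_id, lift_id, hA, hT]
    exact add_eq_left hreg.aleph0_le (Order.le_succ lam)
  refine ⟨BranchSpace r, inferInstance, inferInstance, hT2, hX, fun Y hY => ?_, fun hcwh => ?_⟩
  · refine BranchSpace.metrizableSpace_of_free hlen Y (hfree _ (le_trans ?_ hY))
    exact mk_le_of_injective (f := fun a : {a | BranchSpace.branch a ∈ Y} =>
      (⟨BranchSpace.branch a.1, a.2⟩ : Y)) fun a b hab => Subtype.ext (by simpa using hab)
  · refine BranchSpace.not_isCWH_univ ?_ (hcwh univ (by rw [mk_univ, hX]))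
    rw [hT, hA]
    exact Order.lt_succ lam
end

section
/- Assume Martin's Axiom holds and 2^{ℵ0} > ℵ1. Then there exists a first countable Hausdorff topological space which is ℵ1-metrizable (every subspace of cardinality at most ℵ1 is metrizable), hence ℵ1-CWH, but not CWH, hence not metrizable. -/
open Cardinal Topology

/-- `P` satisfies the countable chain condition: every set of pairwise incompatible
elements is countable. -/
def IsCCC (P : Type) [PartialOrder P] : Prop :=
  ∀ A : Set P, (∀ p ∈ A, ∀ q ∈ A, p ≠ q → ¬∃ r, r ≤ p ∧ r ≤ q) → A.Countable

/-- `D` is dense in the partial order `P`. -/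
def IsDenseBelow (P : Type) [PartialOrder P] (D : Set P) : Prop :=
  ∀ p : P, ∃ q ∈ D, q ≤ p

/-- `G` is a filter on the partial order `P`: upward closed, and any two members have a
common lower bound in `G`. -/
def IsPOFilter (P : Type) [PartialOrder P] (G : Set P) : Prop :=
  (∀ p ∈ G, ∀ q, p ≤ q → q ∈ G) ∧ ∀ p ∈ G, ∀ q ∈ G, ∃ r ∈ G, r ≤ p ∧ r ≤ q

/-- Martin's Axiom. -/
def MartinsAxiom : Prop :=
  ∀ (P : Type) (inst : PartialOrder P), Nonempty P → @IsCCC P inst →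
    ∀ D : Set (Set P), #D < 2 ^ ℵ₀ → (∀ d ∈ D, @IsDenseBelow P inst d) →
      ∃ G : Set P, @IsPOFilter P inst G ∧ ∀ d ∈ D, (G ∩ d).Nonempty

/-- A first countable Hausdorff space which is `ℵ₁`-metrizable (hence `ℵ₁`-CWH) but not CWH
(hence not metrizable). -/
def Stmt4Space (X : Type) [TopologicalSpace X] : Prop :=
  FirstCountableTopology X ∧ T2Space X ∧
  (∀ Y : Set X, #Y ≤ aleph 1 → TopologicalSpace.MetrizableSpace Y) ∧
  (∀ Y : Set X, #Y ≤ aleph 1 → IsCWH Y) ∧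
  ¬IsCWH X ∧ ¬TopologicalSpace.MetrizableSpace X

/-! ### Hechler forcing -/

/-- Hechler conditions: a finite stem together with a finite set of functions that every
later extension of the stem has to dominate. -/
@[ext]
structure Hechler where
  stem : List ℕ
  side : Finset (ℕ → ℕ)

namespace Hechler

instance : PartialOrder Hechler where
  le p q := q.stem <+: p.stem ∧ q.side ⊆ p.side ∧
    ∀ i v, q.stem.length ≤ i → p.stem[i]? = some v → ∀ f ∈ q.side, f i < v
  le_refl p := by
    refine ⟨List.prefix_rfl, subset_rfl, fun i v hi hv => ?_⟩
    rw [List.getElem?_eq_none hi] at hv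
    cases hv
  le_trans p q r hpq hqr := by
    refine ⟨hqr.1.trans hpq.1, hqr.2.1.trans hpq.2.1, fun i v hi hv f hf => ?_⟩
    by_cases h : i < q.stem.length
    · refine hqr.2.2 i v hi ?_ f hf
      rw [← hv, List.getElem?_eq_getElem h]
      exact (List.prefix_iff_getElem?.1 hpq.1 i h).symm
    · exact hpq.2.2 i v (not_lt.1 h) hv f (hqr.2.1 hf)
  le_antisymm p q hpq hqp :=
    Hechler.ext (hqp.1.eq_of_length_le hpq.1.length_le) (hqp.2.1.antisymm hpq.2.1)

theorem le_of_stem_eq {p q : Hechler} (h : p.stem = q.stem) (hs : q.side ⊆ p.side) : p ≤ q := by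
  refine ⟨by rw [h], hs, fun i v hi hv => ?_⟩
  rw [h, List.getElem?_eq_none hi] at hv
  cases hv

theorem isCCC : IsCCC Hechler := by
  classical
  intro A hA
  refine Set.MapsTo.countable_of_injOn (f := Hechler.stem) (Set.mapsTo_univ _ _) ?_
    Set.countable_univ
  intro p hp q hq hpq
  by_contra hne
  exact hA p hp q hq hne ⟨⟨p.stem, p.side ∪ q.side⟩,
    le_of_stem_eq rfl Finset.subset_union_left, le_of_stem_eq hpq Finset.subset_union_right⟩

theorem exists_le_length_succ (p : Hechler) :
    ∃ q ≤ p, q.stem.length = p.stem.length + 1 := by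
  refine ⟨⟨p.stem ++ [p.side.sup (fun f => f p.stem.length) + 1], p.side⟩,
    ⟨List.prefix_append _ _, subset_rfl, fun i v hi hv f hf => ?_⟩, by simp⟩
  have hlt : i < (p.stem ++ [p.side.sup (fun f => f p.stem.length) + 1]).length :=
    (List.getElem?_eq_some_iff.1 hv).1
  have hi' : i = p.stem.length := by
    simp at hlt
    omega
  subst hi'
  simp at hv
  subst hv
  exact Nat.lt_succ_of_le (Finset.le_sup (f := fun f : ℕ → ℕ => f p.stem.length) hf)

theorem exists_le_lt_length (n : ℕ) (p : Hechler) : ∃ q ≤ p, n < q.stem.length := by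
  induction n with
  | zero =>
    obtain ⟨q, hq, hl⟩ := p.exists_le_length_succ
    exact ⟨q, hq, by omega⟩
  | succ n ih =>
    obtain ⟨q, hq, hl⟩ := ih
    obtain ⟨r, hr, hl'⟩ := q.exists_le_length_succ
    exact ⟨r, hr.trans hq, by omega⟩

theorem exists_le_mem_side (f : ℕ → ℕ) (p : Hechler) : ∃ q ≤ p, f ∈ q.side := by
  classical
  exact ⟨⟨p.stem, insert f p.side⟩, le_of_stem_eq rfl (Finset.subset_insert _ _),
    Finset.mem_insert_self _ _⟩

end Hechler

/-- Under Martin's Axiom, fewer than continuum many functions are eventually dominated by a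
single one. -/
theorem MartinsAxiom.exists_dominating (hMA : MartinsAxiom) {A : Set (ℕ → ℕ)}
    (hA : #A < 2 ^ ℵ₀) :
    ∃ g : ℕ → ℕ, ∃ h : (ℕ → ℕ) → ℕ, ∀ f ∈ A, ∀ n, h f ≤ n → f n < g n := by
  let D₁ : Set (Set Hechler) := Set.range fun n : ℕ => {p | n < p.stem.length}
  let D₂ : Set (Set Hechler) := (fun f : ℕ → ℕ => {p : Hechler | f ∈ p.side}) '' A
  have hcard : #(D₁ ∪ D₂ : Set (Set Hechler)) < 2 ^ ℵ₀ := by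
    have hinf : ℵ₀ ≤ (2 : Cardinal.{0}) ^ ℵ₀ := (cantor _).le
    refine (mk_union_le _ _).trans_lt (add_lt_of_lt hinf ?_ (mk_image_le.trans_lt hA))
    exact (mk_le_aleph0_iff.2 (Set.countable_range _)).trans_lt (cantor _)
  obtain ⟨G, hG, hGD⟩ := hMA Hechler inferInstance ⟨⟨[], ∅⟩⟩ Hechler.isCCC (D₁ ∪ D₂) hcard (by
    rintro d (⟨n, rfl⟩ | ⟨f, -, rfl⟩) p
    · obtain ⟨q, hq, hn⟩ := p.exists_le_lt_length n
      exact ⟨q, hn, hq⟩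
    · obtain ⟨q, hq, hn⟩ := p.exists_le_mem_side f
      exact ⟨q, hn, hq⟩)
  have h₁ : ∀ n : ℕ, ∃ q ∈ G, n < q.stem.length := fun n => hGD _ (Or.inl ⟨n, rfl⟩)
  have h₂ : ∀ f : ℕ → ℕ, ∃ p : Hechler, f ∈ A → p ∈ G ∧ f ∈ p.side := by
    intro f
    by_cases hf : f ∈ A
    · obtain ⟨p, hp⟩ := hGD _ (Or.inr ⟨f, hf, rfl⟩)
      exact ⟨p, fun _ => hp⟩
    · exact ⟨⟨[], ∅⟩, fun h => absurd h hf⟩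
  choose q hqG hq using h₁
  choose p hp using h₂
  refine ⟨fun n => (q n).stem[n]'(hq n), fun f => (p f).stem.length, fun f hf n hn => ?_⟩
  obtain ⟨r, -, hrp, hrq⟩ := hG.2 _ (hp f hf).1 _ (hqG n)
  exact hrp.2.2 n _ hn (List.prefix_iff_getElem?.1 hrq.1 n (hq n)) f (hp f hf).2

/-! ### Metrizability and collectionwise Hausdorff spaces -/

theorem isCWH_of_metrizableSpace (X : Type*) [TopologicalSpace X]
    [TopologicalSpace.MetrizableSpace X] : IsCWH X := by
  let _ := TopologicalSpace.metrizableSpaceMetric X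
  intro Y hY
  have h : ∀ y : Y, ∃ r > 0, ∀ z : Y, dist z y < r → z = y := by
    intro y
    obtain ⟨r, hr, hb⟩ := Metric.isOpen_iff.1 (isOpen_discrete {y}) y rfl
    exact ⟨r, hr, fun z hz => hb hz⟩
  choose r hr hrY using h
  refine ⟨fun y => Metric.ball y (r y / 2), fun y => Metric.isOpen_ball,
    fun y => Metric.mem_ball_self (half_pos (hr y)), fun y z hyz => ?_⟩
  rw [Set.disjoint_left]
  intro x hxy hxz
  rw [Metric.mem_ball] at hxy hxz
  have htri : dist (y : X) z < r y / 2 + r z / 2 :=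
    (dist_triangle_left (y : X) z x).trans_lt (add_lt_add hxy hxz)
  rcases le_total (r y) (r z) with hle | hle
  · exact hyz (hrY z y (show dist (y : X) z < r z by linarith))
  · exact hyz (hrY y z (show dist (z : X) y < r y by rw [dist_comm]; linarith)).symm

open Classical in
/-- The hedgehog-like distance attached to a partition into the fibres of `c` and a weight `w`
measuring the distance to the centre of the fibre. -/
noncomputable def fibreDist {X C : Type*} (c : X → C) (w : X → ℝ) (x y : X) : ℝ :=
  if x = y then 0 else if c x = c y then max (w x) (w y) else 1

theorem metrizableSpace_of_fibreDist {X C : Type*} [TopologicalSpace X] (c : X → C) (w : X → ℝ)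
    (w_nonneg : ∀ x, 0 ≤ w x) (w_le : ∀ x, w x ≤ 1)
    (hcw : ∀ x y, c x = c y → w x = 0 → w y = 0 → x = y)
    (H : ∀ s : Set X, IsOpen s ↔ ∀ x ∈ s, ∃ ε > 0, ∀ y, fibreDist c w x y < ε → y ∈ s) :
    TopologicalSpace.MetrizableSpace X := by
  have hself : ∀ x, fibreDist c w x x = 0 := fun x => by simp [fibreDist]
  have hcomm : ∀ x y, fibreDist c w x y = fibreDist c w y x := fun x y => by
    unfold fibreDist
    grind
  have htri : ∀ x y z, fibreDist c w x z ≤ fibreDist c w x y + fibreDist c w y z := by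
    intro x y z
    have hx := w_nonneg x
    have hy := w_nonneg y
    have hz := w_nonneg z
    have hx' := w_le x
    have hy' := w_le y
    have hz' := w_le z
    unfold fibreDist
    grind
  have heq : ∀ x y, fibreDist c w x y = 0 → x = y := by
    intro x y h
    by_contra hne
    rw [fibreDist, if_neg hne] at h
    split_ifs at h with hc
    · exact hne (hcw x y hc
        (le_antisymm ((le_max_left _ _).trans h.le) (w_nonneg x))
        (le_antisymm ((le_max_right _ _).trans h.le) (w_nonneg y)))
    · exact one_ne_zero h
  let _ := MetricSpace.ofDistTopology (fibreDist c w) hself hcomm htri H heq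
  infer_instance

/-! ### The space -/

/-- The points of the space: two kinds of limit points and the isolated points. -/
inductive DomSpace : Type
  | col (n : ℕ)
  | fn (f : ℕ → ℕ)
  | iso (f : ℕ → ℕ) (n : ℕ)

namespace DomSpace

/-- Basic neighbourhoods. -/
def basic : DomSpace → ℕ → Set DomSpace
  | col n, m => {x | x = col n ∨ ∃ f : ℕ → ℕ, m ≤ f n ∧ x = iso f n}
  | fn f, m => {x | x = fn f ∨ ∃ n, m ≤ n ∧ x = iso f n}
  | iso f n, _ => {iso f n}

theorem self_mem_basic (x : DomSpace) (m : ℕ) : x ∈ basic x m := by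
  cases x <;> simp [basic]

theorem basic_anti (x : DomSpace) {m k : ℕ} (h : m ≤ k) : basic x k ⊆ basic x m := by
  cases x with
  | col n =>
    rintro y (rfl | ⟨f, hf, rfl⟩)
    exacts [Or.inl rfl, Or.inr ⟨f, h.trans hf, rfl⟩]
  | fn f =>
    rintro y (rfl | ⟨n, hn, rfl⟩)
    exacts [Or.inl rfl, Or.inr ⟨n, h.trans hn, rfl⟩]
  | iso f n => exact subset_rfl

instance : TopologicalSpace DomSpace where
  IsOpen s := ∀ x ∈ s, ∃ m, basic x m ⊆ s
  isOpen_univ _ _ := ⟨0, Set.subset_univ _⟩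
  isOpen_inter s t hs ht x hx := by
    obtain ⟨m, hm⟩ := hs x hx.1
    obtain ⟨k, hk⟩ := ht x hx.2
    exact ⟨max m k, Set.subset_inter ((basic_anti x (le_max_left _ _)).trans hm)
      ((basic_anti x (le_max_right _ _)).trans hk)⟩
  isOpen_sUnion S hS x := by
    rintro ⟨s, hs, hx⟩
    obtain ⟨m, hm⟩ := hS s hs x hx
    exact ⟨m, hm.trans (Set.subset_sUnion_of_mem hs)⟩

theorem isOpen_iff {s : Set DomSpace} : IsOpen s ↔ ∀ x ∈ s, ∃ m, basic x m ⊆ s := Iff.rfl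

theorem isOpen_basic (x : DomSpace) (m : ℕ) : IsOpen (basic x m) := by
  intro y hy
  rcases eq_or_ne y x with rfl | hne
  · exact ⟨m, subset_rfl⟩
  · refine ⟨0, ?_⟩
    have hiso : ∃ f n, y = iso f n := by
      cases x with
      | col n =>
        rcases hy with rfl | ⟨f, -, rfl⟩
        exacts [absurd rfl hne, ⟨f, n, rfl⟩]
      | fn f =>
        rcases hy with rfl | ⟨n, -, rfl⟩
        exacts [absurd rfl hne, ⟨f, n, rfl⟩]
      | iso f n => exact ⟨f, n, hy⟩
    obtain ⟨f, n, rfl⟩ := hiso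
    rintro z rfl
    exact hy

theorem hasBasis_nhds (x : DomSpace) : (𝓝 x).HasBasis (fun _ : ℕ => True) (basic x) := by
  refine ⟨fun s => ?_⟩
  rw [mem_nhds_iff]
  constructor
  · rintro ⟨t, hts, ht, hx⟩
    obtain ⟨m, hm⟩ := ht x hx
    exact ⟨m, trivial, hm.trans hts⟩
  · rintro ⟨m, -, hm⟩
    exact ⟨basic x m, hm, isOpen_basic x m, self_mem_basic x m⟩

instance : FirstCountableTopology DomSpace :=
  ⟨fun x => (hasBasis_nhds x).isCountablyGenerated⟩

theorem exists_disjoint_basic {x y : DomSpace} (h : x ≠ y) :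
    ∃ m k, Disjoint (basic x m) (basic y k) := by
  simp only [Set.disjoint_left]
  cases x with
  | col n =>
    cases y with
    | col n' => exact ⟨0, 0, by simp only [basic, Set.mem_ofPred_eq]; grind⟩
    | fn f => exact ⟨0, n + 1, by simp only [basic, Set.mem_ofPred_eq]; grind⟩
    | iso f n' =>
      exact ⟨f n' + 1, 0, by simp only [basic, Set.mem_ofPred_eq, Set.mem_singleton_iff]; grind⟩
  | fn f =>
    cases y with
    | col n => exact ⟨n + 1, 0, by simp only [basic, Set.mem_ofPred_eq]; grind⟩
    | fn f' => exact ⟨0, 0, by simp only [basic, Set.mem_ofPred_eq]; grind⟩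
    | iso f' n =>
      exact ⟨n + 1, 0, by simp only [basic, Set.mem_ofPred_eq, Set.mem_singleton_iff]; grind⟩
  | iso f n =>
    cases y with
    | col n' =>
      exact ⟨0, f n + 1, by simp only [basic, Set.mem_ofPred_eq, Set.mem_singleton_iff]; grind⟩
    | fn f' =>
      exact ⟨0, n + 1, by simp only [basic, Set.mem_ofPred_eq, Set.mem_singleton_iff]; grind⟩
    | iso f' n' => exact ⟨0, 0, by simp only [basic, Set.mem_singleton_iff]; grind⟩

instance : T2Space DomSpace := by
  refine ⟨fun x y h => ?_⟩
  obtain ⟨m, k, hd⟩ := exists_disjoint_basic h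
  exact ⟨_, _, isOpen_basic x m, isOpen_basic y k, self_mem_basic x m, self_mem_basic y k, hd⟩

theorem not_isCWH : ¬IsCWH DomSpace := by
  intro h
  let Y : Set DomSpace := {x | ∀ f n, x ≠ iso f n}
  have hY : DiscreteTopology Y := by
    refine discreteTopology_iff_isOpen_singleton.2 fun y => ?_
    refine ⟨basic y 0, isOpen_basic _ _, ?_⟩
    obtain ⟨y, hy⟩ := y
    ext ⟨z, hz⟩
    simp only [Set.mem_preimage, Set.mem_singleton_iff, Subtype.mk.injEq]
    refine ⟨fun hzy => ?_, fun hzy => hzy ▸ self_mem_basic _ _⟩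
    cases y with
    | col n =>
      rcases hzy with rfl | ⟨f, -, rfl⟩
      exacts [rfl, absurd rfl (hz f n)]
    | fn f =>
      rcases hzy with rfl | ⟨n, -, rfl⟩
      exacts [rfl, absurd rfl (hz f n)]
    | iso f n => exact absurd rfl (hy f n)
  obtain ⟨u, hu, hmem, hdisj⟩ := h Y hY
  let a : ℕ → Y := fun n => ⟨col n, fun _ _ => DomSpace.noConfusion⟩
  have hg : ∀ n, ∃ m, basic (col n) m ⊆ u (a n) := fun n => hu (a n) _ (hmem (a n))
  choose g hg using hg
  let b : Y := ⟨fn g, fun _ _ => DomSpace.noConfusion⟩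
  obtain ⟨m, hm⟩ := hu b _ (hmem b)
  have hab : a m ≠ b := fun hab => DomSpace.noConfusion (congrArg Subtype.val hab)
  exact Set.disjoint_left.1 (hdisj _ _ hab) (hg m (Or.inr ⟨g, le_rfl, rfl⟩))
    (hm (Or.inr ⟨m, le_rfl, rfl⟩))

/-- The function a point is attached to. -/
def index : DomSpace → ℕ → ℕ
  | col _ => 0
  | fn f => f
  | iso f _ => f

/-- The limit point to which a point is assigned by a dominating function `g` with
thresholds `h`. -/
def center (g : ℕ → ℕ) (h : (ℕ → ℕ) → ℕ) : DomSpace → DomSpace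
  | iso f n => if h f ≤ n then fn f else if g n ≤ f n then col n else iso f n
  | x => x

/-- The distance of a point to its centre; isolated centres get the value `1`. -/
noncomputable def weight (g : ℕ → ℕ) (h : (ℕ → ℕ) → ℕ) : DomSpace → ℝ
  | iso f n => if h f ≤ n then 1 / (n + 1) else if g n ≤ f n then 1 / (f n + 1) else 1
  | _ => 0

variable {g : ℕ → ℕ} {h : (ℕ → ℕ) → ℕ}

theorem weight_iso_pos (f : ℕ → ℕ) (n : ℕ) : 0 < weight g h (iso f n) := by
  simp only [weight]
  split_ifs <;> positivity

theorem weight_nonneg (x : DomSpace) : 0 ≤ weight g h x := by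
  cases x with
  | iso f n => exact (weight_iso_pos f n).le
  | _ => exact le_rfl

theorem weight_le_one (x : DomSpace) : weight g h x ≤ 1 := by
  have key : ∀ k : ℕ, 1 / ((k : ℝ) + 1) ≤ 1 := fun k =>
    div_le_one_of_le₀ (by linarith [k.cast_nonneg (α := ℝ)]) (by positivity)
  cases x with
  | iso f n =>
    simp only [weight]
    split_ifs
    exacts [key n, key (f n), le_rfl]
  | _ => exact zero_le_one

theorem center_eq_of_weight_eq_zero {x : DomSpace} (hx : weight g h x = 0) :
    center g h x = x := by
  cases x with
  | iso f n => exact absurd hx (weight_iso_pos f n).ne'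
  | _ => rfl

theorem exists_ball_subset_basic (x : DomSpace) (m : ℕ) :
    ∃ ε > 0, ∀ y, fibreDist (center g h) (weight g h) x y < ε → y ∈ basic x m := by
  have hle : 1 / ((m : ℝ) + 1) ≤ 1 :=
    div_le_one_of_le₀ (by linarith [m.cast_nonneg (α := ℝ)]) (by positivity)
  have hlt : ∀ k : ℕ, 1 / ((k : ℝ) + 1) < 1 / ((m : ℝ) + 1) → m ≤ k := fun k hk => by
    have := lt_of_one_div_lt_one_div (by positivity) hk
    have : (m : ℝ) < k := by linarith
    exact_mod_cast this.le
  cases x with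
  | iso f n =>
    refine ⟨_, weight_iso_pos (g := g) (h := h) f n, fun y hy => ?_⟩
    rw [fibreDist] at hy
    split_ifs at hy with h₁ h₂
    · exact h₁.symm
    · exact absurd hy (not_lt.2 (le_max_left _ _))
    · exact absurd hy (not_lt.2 (weight_le_one _))
  | col n =>
    refine ⟨1 / ((m : ℝ) + 1), by positivity, fun y hy => ?_⟩
    rw [fibreDist] at hy
    split_ifs at hy with h₁ h₂
    · exact Or.inl h₁.symm
    · replace hy := (le_max_right _ _).trans_lt hy
      cases y with
      | col n' => exact absurd h₂ h₁
      | fn f => exact absurd h₂ h₁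
      | iso f n' =>
        simp only [center, weight] at h₂ hy
        split_ifs at h₂ hy
        cases h₂
        exact Or.inr ⟨f, hlt _ hy, rfl⟩
    · exact absurd hy (not_lt.2 hle)
  | fn f =>
    refine ⟨1 / ((m : ℝ) + 1), by positivity, fun y hy => ?_⟩
    rw [fibreDist] at hy
    split_ifs at hy with h₁ h₂
    · exact Or.inl h₁.symm
    · replace hy := (le_max_right _ _).trans_lt hy
      cases y with
      | col n' => exact absurd h₂ h₁
      | fn f => exact absurd h₂ h₁
      | iso f' n =>
        simp only [center, weight] at h₂ hy
        split_ifs at h₂ hy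
        cases h₂
        exact Or.inr ⟨n, hlt _ hy, rfl⟩
    · exact absurd hy (not_lt.2 hle)

theorem exists_basic_subset_ball {A : Set (ℕ → ℕ)} (hA : ∀ f ∈ A, ∀ n, h f ≤ n → f n < g n)
    (x : DomSpace) {ε : ℝ} (hε : 0 < ε) :
    ∃ m, ∀ y ∈ basic x m, index y ∈ A → fibreDist (center g h) (weight g h) x y < ε := by
  obtain ⟨k, hk⟩ := exists_nat_one_div_lt hε
  have hlt : ∀ j : ℕ, k ≤ j → 1 / ((j : ℝ) + 1) < ε := fun j hj =>
    (one_div_le_one_div_of_le (by positivity) (by gcongr)).trans_lt hk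
  cases x with
  | iso f n =>
    refine ⟨0, ?_⟩
    rintro y rfl -
    simpa [fibreDist] using hε
  | col n =>
    refine ⟨max (g n) k, ?_⟩
    rintro y (rfl | ⟨f, hf, rfl⟩) hy
    · simpa [fibreDist] using hε
    · have h₁ : ¬h f ≤ n := fun h₁ => by
        have := hA f hy n h₁
        omega
      have h₂ : g n ≤ f n := (le_max_left _ _).trans hf
      simp only [fibreDist, center, weight, if_neg h₁, if_pos h₂, reduceCtorEq, if_true, if_false]
      exact max_lt hε (hlt _ ((le_max_right _ _).trans hf))
  | fn f =>
    refine ⟨max (h f) k, ?_⟩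
    rintro y (rfl | ⟨n, hn, rfl⟩) hy
    · simpa [fibreDist] using hε
    · have h₁ : h f ≤ n := (le_max_left _ _).trans hn
      simp only [fibreDist, center, weight, if_pos h₁, reduceCtorEq, if_true, if_false]
      exact max_lt hε (hlt _ ((le_max_right _ _).trans hn))

theorem metrizableSpace_subtype {Y : Set DomSpace}
    (hA : ∀ f ∈ index '' Y, ∀ n, h f ≤ n → f n < g n) : TopologicalSpace.MetrizableSpace Y := by
  have hdist : ∀ x y : Y, fibreDist (fun z : Y => center g h z) (fun z : Y => weight g h z) x y =
      fibreDist (center g h) (weight g h) x y := fun x y => by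
    simp only [fibreDist]
    congr 1
    exact propext Subtype.ext_iff
  refine metrizableSpace_of_fibreDist (fun z : Y => center g h z) (fun z : Y => weight g h z)
    (fun x => weight_nonneg _) (fun x => weight_le_one _) (fun x y hc hx hy => ?_) fun s => ?_
  · rw [center_eq_of_weight_eq_zero hx, center_eq_of_weight_eq_zero hy] at hc
    exact Subtype.ext hc
  · simp only [hdist]
    rw [isOpen_iff_mem_nhds]
    refine forall₂_congr fun x _ => ?_
    rw [nhds_subtype, ((hasBasis_nhds (x : DomSpace)).comap _).mem_iff]
    constructor
    · rintro ⟨m, -, hm⟩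
      obtain ⟨ε, hε, hb⟩ := exists_ball_subset_basic (g := g) (h := h) (x : DomSpace) m
      exact ⟨ε, hε, fun y hy => hm (hb y hy)⟩
    · rintro ⟨ε, hε, hb⟩
      obtain ⟨m, hm⟩ := exists_basic_subset_ball hA (x : DomSpace) hε
      exact ⟨m, trivial, fun y hy => hb y (hm y hy ⟨y, y.2, rfl⟩)⟩

end DomSpace

theorem stmt4 (hMA : MartinsAxiom) (hCH : aleph 1 < 2 ^ ℵ₀) :
    ∃ (X : Type) (t : TopologicalSpace X), @Stmt4Space X t := by
  have hCH₀ : aleph.{0} 1 < 2 ^ ℵ₀ := by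
    rw [← Cardinal.lift_lt]
    simpa using hCH
  have hmet : ∀ Y : Set DomSpace, #Y ≤ aleph 1 → TopologicalSpace.MetrizableSpace Y := by
    intro Y hY
    obtain ⟨g, h, hgh⟩ := hMA.exists_dominating
      (A := DomSpace.index '' Y) ((mk_image_le.trans hY).trans_lt hCH₀)
    exact DomSpace.metrizableSpace_subtype hgh
  refine ⟨DomSpace, inferInstance, inferInstance, inferInstance, hmet, fun Y hY => ?_,
    DomSpace.not_isCWH, fun _ => DomSpace.not_isCWH (isCWH_of_metrizableSpace _)⟩
  have := hmet Y hY
  exact isCWH_of_metrizableSpace Y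
end

section
/- Let λ be an uncountable cardinal. If there exists a first countable Hausdorff topological space X with λ points which is (<λ)-CWH but not λ-CWH, then INCWH⁴(λ) holds: there is a symmetric function f assigning to each pair (α,β) with α, β < λ a finite subset of ω × ω closed downward (i.e., if (n,m) ∈ f(α,β), n' ≤ n and m' ≤ m, then (n',m') ∈ f(α,β)), such that f is not free — for every g : λ → ω there are α < β < λ with (g(α), g(β)) ∈ f(α,β) — but f is λ-free — for every A ⊆ λ with |A| < λ there is g : A → ω such that for no α < β both in A is (g(α), g(β)) ∈ f(α,β). -/
open Cardinal Topology

/-- A first countable Hausdorff space with `lam` points which is `(<lam)`-CWH but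
not `lam`-CWH. -/
def SINCWHSpace (lam : Cardinal) (X : Type) [TopologicalSpace X] : Prop :=
  FirstCountableTopology X ∧ T2Space X ∧ #X = lam ∧
  (∀ Y : Set X, #Y < lam → IsCWH Y) ∧
  ¬∀ Y : Set X, #Y ≤ lam → IsCWH Y

/-- The principle `INCWH⁴(lam)`: a symmetric assignment of finite downward closed subsets of
`ω × ω` to pairs of ordinals `< lam` which is not free but is `lam`-free. -/
def INCWH4 (lam : Cardinal.{0}) : Prop :=
  ∃ f : Ordinal → Ordinal → Finset (ℕ × ℕ),
    (∀ α β : Ordinal, f α β = f β α) ∧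
    (∀ α β : Ordinal, ∀ p ∈ f α β, ∀ q : ℕ × ℕ, q.1 ≤ p.1 → q.2 ≤ p.2 → q ∈ f α β) ∧
    (∀ g : Ordinal → ℕ, ∃ α β : Ordinal, α < β ∧ β < lam.ord ∧ (g α, g β) ∈ f α β) ∧
    ∀ A : Set Ordinal, A ⊆ Set.Iio lam.ord → #A < Cardinal.lift.{1} lam →
      ∃ g : Ordinal → ℕ, ∀ α ∈ A, ∀ β ∈ A, α < β → (g α, g β) ∉ f α β

/-- To establish `INCWH4 lam` it suffices to give a non-free, `lam`-free assignment on an arbitrary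
index type of cardinality at most `lam`, symmetric up to transposition. -/
theorem INCWH4.of_index {lam : Cardinal.{0}} {I : Type} (hI : #I ≤ lam)
    (G : I → I → Finset (ℕ × ℕ))
    (symm : ∀ i j n m, (n, m) ∈ G i j → (m, n) ∈ G j i)
    (down : ∀ i j, ∀ p ∈ G i j, ∀ q : ℕ × ℕ, q.1 ≤ p.1 → q.2 ≤ p.2 → q ∈ G i j)
    (notFree : ∀ g : I → ℕ, ∃ i j, i ≠ j ∧ (g i, g j) ∈ G i j)
    (free : ∀ A : Set I, #A < lam →
      ∃ g : I → ℕ, ∀ i ∈ A, ∀ j ∈ A, i ≠ j → (g i, g j) ∉ G i j) :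
    INCWH4 lam := by
  classical
  obtain ⟨i₀, -⟩ := notFree fun _ => 0
  have : Nonempty I := ⟨i₀⟩
  have hle : Cardinal.lift.{1} #I ≤ Cardinal.lift.{0} #(Set.Iio lam.ord) := by
    rw [Cardinal.mk_Iio_ordinal]
    simpa using hI
  obtain ⟨e₀⟩ := Cardinal.lift_mk_le'.1 hle
  let e : I → Ordinal.{0} := fun i => (e₀ i : Ordinal)
  have he : Function.Injective e := Subtype.val_injective.comp e₀.injective
  have helt : ∀ i, e i < lam.ord := fun i => (e₀ i).2
  have hinv : ∀ i, Function.invFun e (e i) = i := Function.leftInverse_invFun he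
  let f : Ordinal.{0} → Ordinal.{0} → Finset (ℕ × ℕ) := fun α β =>
    if min α β ∈ Set.range e ∧ max α β ∈ Set.range e then
      G (Function.invFun e (min α β)) (Function.invFun e (max α β)) else ∅
  have hf : ∀ i j, e i < e j → f (e i) (e j) = G i j := by
    intro i j hij
    simp [f, min_eq_left hij.le, max_eq_right hij.le, hinv]
  refine ⟨f, fun α β => by simp only [f, min_comm α β, max_comm α β], ?_, ?_, ?_⟩
  · intro α β p hp q h1 h2
    simp only [f] at hp ⊢
    split_ifs at hp ⊢ with h
    · exact down _ _ p hp q h1 h2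
    · simp at hp
  · intro g
    obtain ⟨i, j, hij, hmem⟩ := notFree fun i => g (e i)
    rcases lt_or_gt_of_ne (he.ne hij) with h | h
    · exact ⟨e i, e j, h, helt j, by rwa [hf i j h]⟩
    · exact ⟨e j, e i, h, helt i, by rw [hf j i h]; exact symm _ _ _ _ hmem⟩
  · intro A _ hA
    have hB : #(e ⁻¹' A) < lam := by
      have h := Cardinal.mk_preimage_of_injective_lift e A he
      rw [← Cardinal.lift_lt.{0, 1}]
      refine lt_of_le_of_lt h ?_
      simpa using hA
    obtain ⟨g, hg⟩ := free _ hB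
    refine ⟨fun α => g (Function.invFun e α), fun α hα β hβ hlt hmem => ?_⟩
    simp only [f, min_eq_left hlt.le, max_eq_right hlt.le] at hmem
    split_ifs at hmem with h
    · obtain ⟨⟨i, rfl⟩, ⟨j, rfl⟩⟩ := h
      rw [hinv, hinv] at hmem
      exact hg i hα j hβ (fun hij => hlt.ne (congrArg e hij)) hmem
    · simp at hmem

/-- On a set of size `ℵ₁` there is a symmetric colouring of pairs by natural numbers that is
unbounded on every uncountable rectangle. -/
theorem exists_coloring_unbounded_on_uncountable_rectangles :
    ∃ (Ω : Type) (c : Ω → Ω → ℕ), #Ω = ℵ₁ ∧ (∀ a b, c a b = c b a) ∧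
      ∀ A B : Set Ω, ¬A.Countable → ¬B.Countable → ∀ k, ∃ a ∈ A, ∃ b ∈ B, k ≤ c a b := by
  let Ω : Type := (ℵ₁ : Cardinal.{0}).ord.ToType
  have hΩ : #Ω = ℵ₁ := Cardinal.mk_ord_toType _
  have hIio : ∀ b : Ω, (Set.Iio b).Countable := by
    intro b
    rw [← Cardinal.le_aleph0_iff_set_countable, ← Order.lt_succ_iff, Cardinal.succ_aleph0]
    exact (Cardinal.mk_Iio_lt b (by simp [Ω])).trans_eq hΩ
  have hinj : ∀ b : Ω, ∃ h : Ω → ℕ, Set.InjOn h (Set.Iio b) :=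
    fun b => Set.countable_iff_exists_injOn.1 (hIio b)
  choose h hh using hinj
  refine ⟨Ω, fun a b => h (max a b) (min a b), hΩ,
    fun a b => by simp only [max_comm a b, min_comm a b], fun A B hA hB k => ?_⟩
  have hAinf : A.Infinite := fun hfin => hA hfin.countable
  obtain ⟨A', hA'A, hA'inf, hA'c⟩ : ∃ A' ⊆ A, A'.Infinite ∧ A'.Countable := by
    let s := hAinf.natEmbedding
    refine ⟨Set.range fun n => (s n : Ω), ?_, ?_, Set.countable_range _⟩
    · rintro _ ⟨n, rfl⟩
      exact (s n).2
    · exact Set.infinite_range_of_injective (Subtype.val_injective.comp s.injective)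
  obtain ⟨b, hbB, hb⟩ : ∃ b ∈ B, ∀ a ∈ A', a < b := by
    by_contra! hcon
    refine hB (Set.Countable.mono (fun b hb => ?_)
      (hA'c.biUnion fun a _ => (Set.countable_singleton a).union (hIio a)))
    obtain ⟨a, ha, hba⟩ := hcon b hb
    simp only [Set.mem_iUnion]
    exact ⟨a, ha, hba.eq_or_lt⟩
  have himg : (h b '' A').Infinite := hA'inf.image ((hh b).mono hb)
  obtain ⟨_, ⟨a, ha, rfl⟩, hk⟩ := himg.exists_gt k
  refine ⟨a, hA'A ha, b, hbB, ?_⟩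
  simpa [max_eq_right (hb a ha).le, min_eq_left (hb a ha).le] using hk.le

/-- If all subspaces of size `< lam` are collectionwise Hausdorff, then fewer than `lam` points of
a discrete set can be separated by basic neighbourhoods. -/
theorem exists_separating_index {lam : Cardinal.{0}} (hlam : ℵ₀ < lam) {X : Type}
    [TopologicalSpace X] (hX : ∀ Y : Set X, #Y < lam → IsCWH Y)
    {u : X → ℕ → Set X} (hu : ∀ x, (𝓝 x).HasAntitoneBasis (u x))
    (Y : Set X) (D : Set Y) [DiscreteTopology D] (A : Set D) (hA : #A < lam) :
    ∃ g : D → ℕ, ∀ i ∈ A, ∀ j ∈ A, i ≠ j →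
      ¬(u (i : Y) (g i) ∩ u (j : Y) (g j) ∩ Y).Nonempty := by
  classical
  let F : A × A × ℕ × ℕ → Set X := fun t => u (t.1 : D).1 t.2.2.1 ∩ u (t.2.1 : D).1 t.2.2.2 ∩ Y
  let w : A × A × ℕ × ℕ → X := fun t =>
    if ht : (F t).Nonempty then ht.some else (t.1 : D).1
  let p : A → X := fun a => ((a : D) : Y)
  let W : Set X := Set.range p ∪ Set.range w
  have hwW : ∀ t, (F t).Nonempty → w t ∈ F t := by
    intro t ht
    simp only [w, dif_pos ht]
    exact ht.some_mem
  have hWcard : #W < lam := by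
    refine (Cardinal.mk_union_le _ _).trans_lt (Cardinal.add_lt_of_lt hlam.le ?_ ?_)
    · exact Cardinal.mk_range_le.trans_lt hA
    · refine Cardinal.mk_range_le.trans_lt ?_
      simp only [Cardinal.mk_prod, Cardinal.lift_id]
      refine Cardinal.mul_lt_of_lt hlam.le hA (Cardinal.mul_lt_of_lt hlam.le hA ?_)
      simpa using hlam
  let E : Set W := {x | ∃ a : A, p a = x}
  have hED : ∀ x : E, ∃ hx : (x : X) ∈ Y, (⟨x, hx⟩ : Y) ∈ D := by
    rintro ⟨x, a, ha⟩
    exact ⟨ha ▸ (a : D).1.2, by simp only [← ha]; exact (a : D).2⟩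
  let φ : E → D := fun x => ⟨⟨x, (hED x).1⟩, (hED x).2⟩
  have hφc : Continuous φ := by fun_prop
  have hφi : Function.Injective φ := by
    intro x y hxy
    have : ((φ x : Y) : X) = (φ y : Y) := by rw [hxy]
    exact Subtype.ext (Subtype.ext this)
  have : DiscreteTopology E := DiscreteTopology.of_continuous_injective hφc hφi
  obtain ⟨v, hvo, hvm, hvd⟩ := hX W hWcard E this
  let q : A → E := fun a => ⟨⟨p a, Or.inl ⟨a, rfl⟩⟩, a, rfl⟩
  have hn : ∀ a : A, ∃ n, ∀ x : W, (x : X) ∈ u (p a) n → x ∈ v (q a) := by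
    intro a
    obtain ⟨O, hO, hOv⟩ := isOpen_induced_iff.1 (hvo (q a))
    have hpO : p a ∈ O := by
      have := hvm (q a)
      rw [← hOv] at this
      exact this
    obtain ⟨n, -, hn⟩ := (hu (p a)).1.mem_iff.1 (hO.mem_nhds hpO)
    refine ⟨n, fun x hx => ?_⟩
    rw [← hOv]
    exact hn hx
  choose n hn using hn
  refine ⟨fun i => if hi : i ∈ A then n ⟨i, hi⟩ else 0, fun i hi j hj hij hne => ?_⟩
  simp only [dif_pos hi, dif_pos hj] at hne
  have hz := hwW (⟨i, hi⟩, ⟨j, hj⟩, n ⟨i, hi⟩, n ⟨j, hj⟩) hne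
  set z := w (⟨i, hi⟩, ⟨j, hj⟩, n ⟨i, hi⟩, n ⟨j, hj⟩) with hzdef
  have hzW : z ∈ W := Or.inr ⟨_, rfl⟩
  have hqne : q ⟨i, hi⟩ ≠ q ⟨j, hj⟩ := by
    intro h
    have h' : ((i : Y) : X) = (j : Y) := congrArg (fun x : E => ((x : W) : X)) h
    exact hij (Subtype.ext (Subtype.ext h'))
  exact Set.disjoint_left.1 (hvd _ _ hqne) (hn ⟨i, hi⟩ ⟨z, hzW⟩ hz.1.1)
    (hn ⟨j, hj⟩ ⟨z, hzW⟩ hz.1.2)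

theorem stmt11 (lam : Cardinal.{0}) (hlam : ℵ₀ < lam)
    (h : ∃ (X : Type) (t : TopologicalSpace X), @SINCWHSpace lam X t) :
    INCWH4 lam := by
  classical
  obtain ⟨X, _, _, -, hcard, hsmall, hbig⟩ := h
  simp only [IsCWH, not_forall] at hbig
  obtain ⟨Y, -, D, hD, hsep⟩ := hbig
  have hbasis : ∀ x : X, ∃ u : ℕ → Set X, (∀ n, x ∈ u n ∧ IsOpen (u n)) ∧
      (𝓝 x).HasAntitoneBasis u := fun x => (nhds_basis_opens x).exists_antitone_subbasis
  choose u hu hub using hbasis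
  obtain ⟨Ω, c, hΩ, hcs, hc⟩ := exists_coloring_unbounded_on_uncountable_rectangles
  have : Uncountable Ω := by
    rw [← Cardinal.aleph0_lt_mk_iff, hΩ]
    exact Cardinal.aleph0_lt_aleph_one
  let F : D → D → ℕ × ℕ → Prop := fun x y t => x ≠ y ∧ (u x.1 t.1 ∩ u y.1 t.2 ∩ Y).Nonempty
  let G : D × Ω → D × Ω → Finset (ℕ × ℕ) := fun s t =>
    {r ∈ Finset.range (c s.2 t.2) ×ˢ Finset.range (c s.2 t.2) | F s.1 t.1 r}
  have hG : ∀ s t n m, (n, m) ∈ G s t ↔ (n < c s.2 t.2 ∧ m < c s.2 t.2) ∧ F s.1 t.1 (n, m) := by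
    intro s t n m
    simp [G]
  refine INCWH4.of_index (I := D × Ω) ?_ G ?_ ?_ ?_ ?_
  · have h1 : #D ≤ lam :=
      (Cardinal.mk_set_le D).trans ((Cardinal.mk_set_le Y).trans hcard.le)
    have h2 : #Ω ≤ lam := by
      rw [hΩ, ← Cardinal.succ_aleph0]
      exact Order.succ_le_of_lt hlam
    simp only [Cardinal.mk_prod, Cardinal.lift_id]
    exact (mul_le_mul' h1 h2).trans (Cardinal.mul_eq_self hlam.le).le
  · intro s t n m hmem
    rw [hG] at hmem ⊢
    refine ⟨by rw [hcs]; exact hmem.1.symm, hmem.2.1.symm, ?_⟩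
    rw [Set.inter_comm (u _ _)]
    exact hmem.2.2
  · rintro s t ⟨n, m⟩ hmem ⟨n', m'⟩ hn hm
    rw [hG] at hmem ⊢
    refine ⟨⟨hn.trans_lt hmem.1.1, hm.trans_lt hmem.1.2⟩, hmem.2.1, hmem.2.2.mono ?_⟩
    exact Set.inter_subset_inter_left _
      (Set.inter_subset_inter ((hub _).antitone hn) ((hub _).antitone hm))
  · intro g
    have hfib : ∀ x : D, ∃ n, ¬((fun a : Ω => g (x, a)) ⁻¹' {n}).Countable := by
      intro x
      obtain ⟨n, hn⟩ := Cardinal.exists_uncountable_fiber (fun a : Ω => g (x, a))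
        (by rw [hΩ, Cardinal.mk_nat]; exact Cardinal.aleph0_lt_aleph_one)
      exact ⟨n, fun hcount => not_countable hcount.to_subtype⟩
    choose n hn using hfib
    obtain ⟨x, y, hF⟩ : ∃ x y, F x y (n x, n y) := by
      by_contra! hcon
      refine hsep ⟨fun x => Subtype.val ⁻¹' u x.1 (n x),
        fun x => (hu _ _).2.preimage continuous_subtype_val, fun x => (hu _ _).1,
        fun x y hxy => Set.disjoint_left.2 fun z hzx hzy => hcon x y ⟨hxy, z, ⟨hzx, hzy⟩, z.2⟩⟩
    obtain ⟨a, ha, b, hb, hab⟩ := hc _ _ (hn x) (hn y) (max (n x) (n y) + 1)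
    simp only [Set.mem_preimage, Set.mem_singleton_iff] at ha hb
    refine ⟨(x, a), (y, b), fun hxy => hF.1 (congrArg Prod.fst hxy), ?_⟩
    rw [hG, ha, hb]
    exact ⟨⟨by simp only; omega, by simp only; omega⟩, hF⟩
  · intro A hA
    obtain ⟨g, hg⟩ := exists_separating_index hlam hsmall hub Y D (Prod.fst '' A)
      (Cardinal.mk_image_le.trans_lt hA)
    refine ⟨fun s => g s.1, fun s hs t ht _ hmem => ?_⟩
    rw [hG] at hmem
    exact hg s.1 ⟨s, hs, rfl⟩ t.1 ⟨t, ht, rfl⟩ hmem.2.1 hmem.2.2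
end
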